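/- Let m be odd, let i satisfy gcd(i,m) = 1, set e = 2^i + 1, and let λ ∈ GF(2^m)\{0} be such that f_λ(x) = Tr^m(λ·x^e) is balanced and semi-bent. Let T = {α ∈ GF(2^m) : Ŵ_{f_λ}(α) = 0}. Then T^⊥ = {0, λ^{−1/e}}, where λ^{−1/e} denotes the unique element z ∈ GF(2^m) with z^e = λ^{−1} (which exists and is unique since gcd(e, 2^m − 1) = 1 for odd m). -/

import Mathlib

open Finset
noncomputable section
open scoped Classical

/-- `GF n` is the finite field with `2^n` elements. -/
abbrev GF (n : ℕ) : Type := GaloisField 2 n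

noncomputable instance (n : ℕ) : Fintype (GF n) := Fintype.ofFinite _

/-- The absolute trace map `GF n → 𝔽₂`. -/
def tr {n : ℕ} (x : GF n) : ZMod 2 := Algebra.trace (ZMod 2) (GF n) x

/-- The Walsh transform of a Boolean function `f : GF m → 𝔽₂` at `a`. -/
def walshB {m : ℕ} (f : GF m → ZMod 2) (a : GF m) : ℤ :=
  ∑ x : GF m, (-1 : ℤ) ^ (f x + tr (a * x)).val

/-- The sign character `c ↦ (-1)^c` of `𝔽₂`. -/
def sgn (c : ZMod 2) : ℤ := (-1 : ℤ) ^ c.val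

lemma sgn_add (a b : ZMod 2) : sgn (a + b) = sgn a * sgn b := by
  revert a b; decide

lemma sgn_mul_self (a : ZMod 2) : sgn a * sgn a = 1 := by
  revert a; decide

lemma sgn_zero : sgn 0 = 1 := rfl

lemma sgn_one : sgn 1 = -1 := rfl

lemma zmod_two_eq_zero_or_one (c : ZMod 2) : c = 0 ∨ c = 1 := by
  revert c; decide

lemma tr_add {n : ℕ} (x y : GF n) : tr (x + y) = tr x + tr y :=
  map_add (Algebra.trace (ZMod 2) (GF n)) x y

lemma tr_zero {n : ℕ} : tr (0 : GF n) = 0 :=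
  map_zero (Algebra.trace (ZMod 2) (GF n))

lemma tr_frobenius {n : ℕ} (x : GF n) : tr (x ^ 2) = tr x := by
  have h := Algebra.trace_eq_of_algEquiv (FiniteField.frobeniusAlgEquiv (ZMod 2) (GF n) 2) x
  simpa [tr, ZMod.card] using h

lemma tr_pow_two_pow {n : ℕ} (i : ℕ) (x : GF n) : tr (x ^ 2 ^ i) = tr x := by
  induction i with
  | zero => simp
  | succ i ih => rw [pow_succ, pow_mul, tr_frobenius, ih]

lemma tr_one_of_odd {n : ℕ} (hn : Odd n) : tr (1 : GF n) = 1 := by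
  have h := Algebra.trace_algebraMap (S := GF n) (1 : ZMod 2)
  rw [map_one, GaloisField.finrank 2 hn.pos.ne'] at h
  rw [tr, h, nsmul_one]
  exact (ZMod.natCast_eq_one_iff_odd).2 hn

lemma exists_tr_mul_eq_one {n : ℕ} {c : GF n} (hc : c ≠ 0) : ∃ y : GF n, tr (y * c) = 1 := by
  by_contra! h
  refine hc ((traceForm_nondegenerate (ZMod 2) (GF n)).1 c fun y => ?_)
  rw [Algebra.traceForm_apply, mul_comm]
  exact (zmod_two_eq_zero_or_one _).resolve_right (h y)

lemma card_GF {n : ℕ} (hn : n ≠ 0) : Fintype.card (GF n) = 2 ^ n := by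
  rw [← Nat.card_eq_fintype_card, GaloisField.card 2 n hn]

lemma sum_sgn_tr_mul_of_ne_zero {n : ℕ} {c : GF n} (hc : c ≠ 0) :
    ∑ a : GF n, sgn (tr (a * c)) = 0 := by
  obtain ⟨y, hy⟩ := exists_tr_mul_eq_one hc
  have h := Equiv.sum_comp (Equiv.addRight y) fun a : GF n => sgn (tr (a * c))
  simp only [Equiv.coe_addRight, add_mul, tr_add, hy, sgn_add, sgn_one, mul_neg, mul_one,
    sum_neg_distrib] at h
  linarith

lemma sum_sgn_tr_mul {n : ℕ} (hn : n ≠ 0) (c : GF n) :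
    ∑ a : GF n, sgn (tr (a * c)) = if c = 0 then 2 ^ n else 0 := by
  split_ifs with hc
  · simp [hc, tr_zero, sgn_zero, card_GF hn]
  · exact sum_sgn_tr_mul_of_ne_zero hc

lemma walshB_eq_sum_sgn {n : ℕ} (f : GF n → ZMod 2) (a : GF n) :
    walshB f a = ∑ x, sgn (f x) * sgn (tr (a * x)) := by
  simp only [← sgn_add]; rfl

/-- Parseval's identity for the Walsh transform. -/
lemma sum_walshB_sq {n : ℕ} (hn : n ≠ 0) (f : GF n → ZMod 2) :
    ∑ a, walshB f a ^ 2 = 2 ^ n * 2 ^ n := by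
  have h1 : ∀ a, walshB f a ^ 2 =
      ∑ x, ∑ y, sgn (f x) * sgn (f y) * sgn (tr (a * (x + y))) := by
    intro a
    rw [sq, walshB_eq_sum_sgn, sum_mul_sum]
    refine sum_congr rfl fun x _ => sum_congr rfl fun y _ => ?_
    rw [mul_add, tr_add, sgn_add]
    ring
  have h2 : ∀ x, ∑ a, ∑ y, sgn (f x) * sgn (f y) * sgn (tr (a * (x + y))) = 2 ^ n := by
    intro x
    rw [sum_comm]
    simp only [← mul_sum, sum_sgn_tr_mul hn, CharTwo.add_eq_zero, mul_ite, mul_zero]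
    simp [sgn_mul_self]
  simp only [h1]
  rw [sum_comm]
  simp only [h2]
  simp [card_GF hn]

/-- A linear structure of derivative one forces the Walsh transform to vanish on its orthogonal. -/
lemma walshB_eq_zero_of_add_eq {n : ℕ} {f : GF n → ZMod 2} {z : GF n}
    (hf : ∀ x, f (x + z) = f x + 1) {a : GF n} (ha : tr (a * z) = 0) : walshB f a = 0 := by
  have h := Equiv.sum_comp (Equiv.addRight z) fun x : GF n => sgn (f x) * sgn (tr (a * x))
  simp only [Equiv.coe_addRight, hf, mul_add, tr_add, ha, sgn_add, sgn_one, sgn_zero, mul_neg,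
    mul_one, neg_mul, sum_neg_distrib, ← walshB_eq_sum_sgn] at h
  linarith

lemma tr_mul_eq_zero_of_walshB_eq_zero {n : ℕ} (hn : n ≠ 0) {f : GF n → ZMod 2} {z : GF n}
    (hz : z ≠ 0) (hf : ∀ x, f (x + z) = f x + 1)
    (hb : ∀ a, walshB f a ^ 2 ≤ 2 ^ (n + 1)) {a : GF n} (ha : walshB f a = 0) :
    tr (a * z) = 0 := by
  have hnonneg : ∀ a ∈ (univ : Finset (GF n)),
      0 ≤ 2 ^ n * (1 - sgn (tr (a * z))) - walshB f a ^ 2 := by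
    intro a _
    rcases zmod_two_eq_zero_or_one (tr (a * z)) with h | h
    · simp [h, sgn_zero, walshB_eq_zero_of_add_eq hf h]
    · rw [h, sgn_one]
      have := hb a
      rw [pow_succ 2 n] at this
      linarith
  have hsum : ∑ a, (2 ^ n * (1 - sgn (tr (a * z))) - walshB f a ^ 2) = 0 := by
    rw [sum_sub_distrib, ← mul_sum, sum_sub_distrib, sum_sgn_tr_mul_of_ne_zero hz,
      sum_walshB_sq hn]
    simp [card_GF hn]
  have h := (sum_eq_zero_iff_of_nonneg hnonneg).1 hsum a (mem_univ a)
  refine (zmod_two_eq_zero_or_one _).resolve_right fun h1 => ?_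
  rw [ha, h1, sgn_one] at h
  have : (0 : ℤ) < 2 ^ n := by positivity
  linarith

lemma eq_zero_or_eq_of_tr_mul_eq_zero {n : ℕ} {x z : GF n} (hz : z ≠ 0)
    (h : ∀ y, tr (y * z) = 0 → tr (x * y) = 0) : x = 0 ∨ x = z := by
  obtain ⟨y₀, hy₀⟩ := exists_tr_mul_eq_one hz
  by_contra! hx
  have hxz : x + z ≠ 0 := fun h0 => hx.2 (CharTwo.add_eq_zero.1 h0)
  obtain ⟨u, hu⟩ := exists_tr_mul_eq_one hx.1
  obtain ⟨v, hv⟩ := exists_tr_mul_eq_one hxz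
  have hcomm : ∀ y, tr (x * y) = tr (y * x) := fun y => by rw [mul_comm]
  have key : ∀ y w, tr (y * z) = 1 → tr (w * z) = 1 → tr (y * x) = tr (w * x) := by
    intro y w hy hw
    have := h (y + w) (by rw [add_mul, tr_add, hy, hw]; decide)
    rw [hcomm, add_mul, tr_add] at this
    exact CharTwo.add_eq_zero.1 this
  rw [mul_add, tr_add] at hv
  have huz : tr (u * z) = 1 := (zmod_two_eq_zero_or_one _).resolve_left fun h0 => by
    have := h u h0
    rw [hcomm, hu] at this
    exact one_ne_zero this
  rcases zmod_two_eq_zero_or_one (tr (v * z)) with h0 | h1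
  · have := h v h0
    rw [hcomm] at this
    rw [this, h0] at hv
    exact absurd hv (by decide)
  · rw [key v u h1 huz, hu, h1] at hv
    exact absurd hv (by decide)

/-- The root `z` of `λ z^(2^i+1) = 1` is a linear structure of the Gold function. -/
lemma tr_gold_add {n : ℕ} (hn : Odd n) (i : ℕ) {lam z : GF n}
    (hz : lam * z ^ (2 ^ i + 1) = 1) (x : GF n) :
    tr (lam * (x + z) ^ (2 ^ i + 1)) = tr (lam * x ^ (2 ^ i + 1)) + 1 := by
  have hz0 : z ≠ 0 := by
    rintro rfl
    simp at hz
  have h1 : lam * (x ^ 2 ^ i * z) = (x / z) ^ 2 ^ i := by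
    rw [div_pow, eq_div_iff (pow_ne_zero _ hz0)]
    linear_combination x ^ 2 ^ i * hz
  have h2 : lam * (x * z ^ 2 ^ i) = x / z := by
    rw [eq_div_iff hz0]
    linear_combination x * hz
  have h : lam * (x + z) ^ (2 ^ i + 1) =
      lam * x ^ (2 ^ i + 1) + 1 + ((x / z) ^ 2 ^ i + x / z) := by
    rw [← h1, ← h2, pow_succ (x + z), add_pow_char_pow]
    linear_combination hz
  rw [h, tr_add, tr_add, tr_add, tr_pow_two_pow, tr_one_of_odd hn, CharTwo.add_self_eq_zero,
    add_zero]

/-- for a Gold component function `f_λ(x) = Tr(λ·x^e)`, `e = 2^i + 1`,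
`gcd(i,m) = 1`, `m = 2k+1` odd, which is balanced and semi-bent, the orthogonal of
`T = {α : Ŵ_{f_λ}(α) = 0}` is `{0, λ^{-1/e}}`, where `λ^{-1/e}` is the unique `e`-th
root of `λ⁻¹`. -/
theorem stmt10 (m k i : ℕ) (hm : m = 2 * k + 1) (hi : Nat.gcd i m = 1)
    (e : ℕ) (he : e = 2 ^ i + 1)
    (lam : GF m) (hlam : lam ≠ 0)
    (f : GF m → ZMod 2) (hf : ∀ x : GF m, f x = tr (lam * x ^ e))
    (hbal : (univ.filter (fun x : GF m => f x = 1)).card = 2 ^ (m - 1))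
    (hsb : ∀ a : GF m, walshB f a ∈ ({0, 2 ^ (k + 1), -(2 ^ (k + 1))} : Set ℤ))
    (z : GF m) (hz : z ^ e = lam⁻¹) :
    {x : GF m | ∀ y : GF m, walshB f y = 0 → tr (x * y) = 0} = {0, z} := by
  subst he
  have hodd : Odd m := ⟨k, hm⟩
  have hm0 : m ≠ 0 := hodd.pos.ne'
  have hlz : lam * z ^ (2 ^ i + 1) = 1 := by rw [hz, mul_inv_cancel₀ hlam]
  have hz0 : z ≠ 0 := by
    rintro rfl
    simp at hlz
  have hadd : ∀ x, f (x + z) = f x + 1 := fun x => by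
    rw [hf, hf, tr_gold_add hodd i hlz]
  have hb : ∀ a, walshB f a ^ 2 ≤ 2 ^ (m + 1) := by
    intro a
    have hpow : ((2 : ℤ) ^ (k + 1)) ^ 2 = 2 ^ (m + 1) := by
      rw [← pow_mul, hm]
      congr 1
      ring
    rcases hsb a with h | h | h
    · rw [h]
      positivity
    · rw [h, hpow]
    · rw [h, neg_sq, hpow]
  ext x
  simp only [Set.mem_ofPred_eq, Set.mem_insert_iff, Set.mem_singleton_iff]
  constructor
  · exact fun h => eq_zero_or_eq_of_tr_mul_eq_zero hz0 fun y hy =>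
      h y (walshB_eq_zero_of_add_eq hadd hy)
  · rintro (rfl | rfl) y hy
    · rw [zero_mul, tr_zero]
    · rw [mul_comm]
      exact tr_mul_eq_zero_of_walshB_eq_zero hm0 hz0 hadd hb hy
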